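/- A countable linear order L is sp-homogeneous if and only if its colored condensation Φ(L) is a homogeneous colored linear order. -/

import Mathlib

/- `sFun x` is the successor of `x` if it exists, and `x` otherwise. -/
open Classical in
noncomputable def sFun {L : Type*} [LinearOrder L] (x : L) : L :=
  if h : ∃ y, x ⋖ y then h.choose else x

/- `pFun x` is the predecessor of `x` if it exists, and `x` otherwise. -/
open Classical in
noncomputable def pFun {L : Type*} [LinearOrder L] (x : L) : L :=
  if h : ∃ y, y ⋖ x then h.choose else x

/-- The closure of a set under the successor and predecessor functions. -/
def spClosure (L : Type*) [LinearOrder L] (A : Set L) : Set L :=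
  ⋂₀ {B : Set L | A ⊆ B ∧ ∀ x ∈ B, sFun x ∈ B ∧ pFun x ∈ B}

/-- A linear order is sp-homogeneous if every order-preserving, `s`- and `p`-commuting
bijection between the sp-closures of two finite tuples that sends one tuple to the other
extends to an order-automorphism commuting with `s` and `p` and sending the one tuple
to the other. -/
def IsSPHomogeneous (L : Type*) [LinearOrder L] : Prop :=
  ∀ (n : ℕ) (a b : Fin n → L),
    (∃ g : L → L,
      Set.BijOn g (spClosure L (Set.range a)) (spClosure L (Set.range b)) ∧
      (∀ x ∈ spClosure L (Set.range a), ∀ y ∈ spClosure L (Set.range a),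
        (x < y ↔ g x < g y)) ∧
      (∀ x ∈ spClosure L (Set.range a), g (sFun x) = sFun (g x)) ∧
      (∀ x ∈ spClosure L (Set.range a), g (pFun x) = pFun (g x)) ∧
      (∀ i, g (a i) = b i)) →
    ∃ σ : L ≃o L, (∀ x, σ (sFun x) = sFun (σ x)) ∧ (∀ x, σ (pFun x) = pFun (σ x)) ∧
      ∀ i, σ (a i) = b i

/-- `HasSuccChain i x` : there is a chain `x = x₀ ⋖ x₁ ⋖ ⋯ ⋖ xᵢ` (x has at least `i`
successors); this is the relation `S_i`. -/
def HasSuccChain {L : Type*} [LinearOrder L] : ℕ → L → Prop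
  | 0, _ => True
  | (i+1), x => ∃ y, x ⋖ y ∧ HasSuccChain i y

/-- `HasPredChain i x` : there is a chain `xᵢ ⋖ ⋯ ⋖ x₁ ⋖ x₀ = x` (x has at least `i`
predecessors); this is the relation `P_i`. -/
def HasPredChain {L : Type*} [LinearOrder L] : ℕ → L → Prop
  | 0, _ => True
  | (i+1), x => ∃ y, y ⋖ x ∧ HasPredChain i y

/-- `AdjRel k x y` : `x < y` and exactly `k` elements lie strictly between them. -/
def AdjRel {L : Type*} [LinearOrder L] (k : ℕ) (x y : L) : Prop :=
  x < y ∧ (Set.Ioo x y).Finite ∧ (Set.Ioo x y).ncard = k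

/-- `L` is `C_{n,m}`-homogeneous: every bijection between two finite subsets of `L`
preserving (in both directions) the order, the relations `S_i` for `i < n`, `P_j` for
`j < m`, and `Adj_k` for `k < n + m` extends to an order-automorphism of `L`. -/
def CnmHomogeneous (n m : ℕ∞) (L : Type*) [LinearOrder L] : Prop :=
  ∀ (A : Finset L) (g : L → L), Set.InjOn g ↑A →
    (∀ x ∈ A, ∀ y ∈ A, (x < y ↔ g x < g y)) →
    (∀ i : ℕ, (i : ℕ∞) < n → ∀ x ∈ A, (HasSuccChain i x ↔ HasSuccChain i (g x))) →
    (∀ j : ℕ, (j : ℕ∞) < m → ∀ x ∈ A, (HasPredChain j x ↔ HasPredChain j (g x))) →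
    (∀ k : ℕ, (k : ℕ∞) < n + m → ∀ x ∈ A, ∀ y ∈ A,
      (AdjRel k x y ↔ AdjRel k (g x) (g y))) →
    ∃ σ : L ≃o L, ∀ x ∈ A, σ x = g x

/-- `Sim1 x y` (written `x ∼₁ y`): only finitely many elements lie between `x` and `y`. -/
def Sim1 {L : Type*} [LinearOrder L] (x y : L) : Prop :=
  (Set.Ioo (min x y) (max x y)).Finite

/-- The `∼₁`-block of `x`. -/
def spBlock (L : Type*) [LinearOrder L] (x : L) : Set L := {y | Sim1 x y}

/-- The carrier of the condensation `L/∼₁`: the set of `∼₁`-blocks of `L`. -/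
def Blocks (L : Type*) [LinearOrder L] : Type _ := {B : Set L // ∃ x : L, spBlock L x = B}

/-- The induced (strict) linear order on the blocks of `L`. -/
def BlocksLT (L : Type*) [LinearOrder L] (B B' : Blocks L) : Prop :=
  ∃ a ∈ B.1, ∃ b ∈ B'.1, a < b ∧ ¬ Sim1 a b

/- The color of a block: a finite block of size `n` receives the color `Sum.inl n`,
and blocks of type `ω`, `ω*`, `ζ` receive the further distinct colors
`Sum.inr 0`, `Sum.inr 1`, `Sum.inr 2` respectively. -/
open Classical in
noncomputable def blockColor {L : Type*} [LinearOrder L] (B : Set L) : ℕ ⊕ Fin 3 :=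
  if B.Finite then Sum.inl B.ncard
  else if Nonempty (↥B ≃o ℕ) then Sum.inr 0
  else if Nonempty (↥B ≃o ℕᵒᵈ) then Sum.inr 1
  else Sum.inr 2

/-- A structure consisting of a strict order `lt` and a coloring `c` is homogeneous if
every bijection between two finite subsets preserving the order and the colors extends
to a color-preserving order-automorphism. -/
def ColoredHomogeneousRel {α : Type*} (lt : α → α → Prop) {C : Type*} (c : α → C) : Prop :=
  ∀ (A : Finset α) (g : α → α), Set.InjOn g ↑A →
    (∀ x ∈ A, ∀ y ∈ A, (lt x y ↔ lt (g x) (g y))) →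
    (∀ x ∈ A, c (g x) = c x) →
    ∃ σ : α ≃ α, (∀ x y, lt x y ↔ lt (σ x) (σ y)) ∧ (∀ x, c (σ x) = c x) ∧
      ∀ x ∈ A, σ x = g x

section Condensation

variable {L : Type*} [LinearOrder L]

theorem sim1_iff_finite_uIcc {x y : L} : Sim1 x y ↔ (Set.uIcc x y).Finite := by
  constructor
  · intro h
    refine (h.union (Set.toFinite {min x y, max x y})).subset fun z hz => ?_
    rcases eq_or_lt_of_le hz.1 with h1 | h1
    · exact Or.inr (Or.inl h1.symm)
    rcases eq_or_lt_of_le hz.2 with h2 | h2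
    · exact Or.inr (Or.inr h2)
    · exact Or.inl ⟨h1, h2⟩
  · exact fun h => h.subset Set.Ioo_subset_Icc_self

theorem Sim1.refl (x : L) : Sim1 x x := by
  simp [sim1_iff_finite_uIcc]

theorem Sim1.symm {x y : L} (h : Sim1 x y) : Sim1 y x := by
  rwa [sim1_iff_finite_uIcc, Set.uIcc_comm, ← sim1_iff_finite_uIcc]

theorem Sim1.trans {x y z : L} (h : Sim1 x y) (h' : Sim1 y z) : Sim1 x z := by
  rw [sim1_iff_finite_uIcc] at *
  exact (h.union h').subset Set.uIcc_subset_uIcc_union_uIcc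

theorem Sim1.left_of_le {x y z : L} (h : Sim1 x z) (hxy : x ≤ y) (hyz : y ≤ z) : Sim1 x y := by
  rw [sim1_iff_finite_uIcc] at *
  exact h.subset (Set.uIcc_subset_uIcc_left (Set.mem_uIcc_of_le hxy hyz))

theorem Sim1.right_of_le {x y z : L} (h : Sim1 x z) (hxy : x ≤ y) (hyz : y ≤ z) : Sim1 y z :=
  (h.left_of_le hxy hyz).symm.trans h

theorem CovBy.sim1 {x y : L} (h : x ⋖ y) : Sim1 x y := by
  simp [Sim1, min_eq_left h.le, max_eq_right h.le, h.Ioo_eq]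

theorem sim1_orderIso_iff (σ : L ≃o L) {x y : L} : Sim1 (σ x) (σ y) ↔ Sim1 x y := by
  have : Set.uIcc (σ x) (σ y) = σ '' Set.uIcc x y := by
    rw [Set.uIcc, Set.uIcc, σ.image_Icc, map_inf, map_sup]
  rw [sim1_iff_finite_uIcc, sim1_iff_finite_uIcc, this, Set.finite_image_iff σ.injective.injOn]

theorem CovBy.sFun_eq {x y : L} (h : x ⋖ y) : sFun x = y := by
  have hex : ∃ y, x ⋖ y := ⟨y, h⟩
  rw [sFun, dif_pos hex]
  exact hex.choose_spec.unique_right h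

theorem sFun_eq_self {x : L} (h : ¬ ∃ y, x ⋖ y) : sFun x = x := dif_neg h

theorem CovBy.pFun_eq {x y : L} (h : y ⋖ x) : pFun x = y := by
  have hex : ∃ y, y ⋖ x := ⟨y, h⟩
  rw [pFun, dif_pos hex]
  exact hex.choose_spec.unique_left h

theorem pFun_eq_self {x : L} (h : ¬ ∃ y, y ⋖ x) : pFun x = x := dif_neg h

theorem sim1_sFun (x : L) : Sim1 x (sFun x) := by
  by_cases h : ∃ y, x ⋖ y
  · obtain ⟨y, h⟩ := h
    rw [h.sFun_eq]
    exact h.sim1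
  · rw [sFun_eq_self h]
    exact Sim1.refl x

theorem sim1_pFun (x : L) : Sim1 x (pFun x) := by
  by_cases h : ∃ y, y ⋖ x
  · obtain ⟨y, h⟩ := h
    rw [h.pFun_eq]
    exact h.sim1.symm
  · rw [pFun_eq_self h]
    exact Sim1.refl x

theorem Sim1.exists_covBy_le {x y : L} (h : Sim1 x y) (hxy : x < y) : ∃ z, x ⋖ z ∧ z ≤ y := by
  rw [sim1_iff_finite_uIcc, Set.uIcc_of_le hxy.le] at h
  obtain ⟨z, hz, hmin⟩ := Set.exists_min_image (Set.Ioc x y) id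
    (h.subset Set.Ioc_subset_Icc_self) ⟨y, hxy, le_rfl⟩
  exact ⟨z, ⟨hz.1, fun w hxw hwz => (hmin w ⟨hxw, hwz.le.trans hz.2⟩).not_gt hwz⟩, hz.2⟩

theorem Sim1.exists_le_covBy {x y : L} (h : Sim1 x y) (hxy : x < y) : ∃ z, z ⋖ y ∧ x ≤ z := by
  rw [sim1_iff_finite_uIcc, Set.uIcc_of_le hxy.le] at h
  obtain ⟨z, hz, hmax⟩ := Set.exists_max_image (Set.Ico x y) id
    (h.subset Set.Ico_subset_Icc_self) ⟨x, le_rfl, hxy⟩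
  exact ⟨z, ⟨hz.2, fun w hzw hwy => (hmax w ⟨hz.1.trans hzw.le, hwy⟩).not_gt hzw⟩, hz.1⟩

theorem Sim1.mem_of_closed {B : Set L} (hB : ∀ x ∈ B, sFun x ∈ B ∧ pFun x ∈ B) {x y : L}
    (h : Sim1 x y) (hx : x ∈ B) : y ∈ B := by
  have hfin := sim1_iff_finite_uIcc.1 h
  rcases le_total x y with hxy | hyx
  · rw [Set.uIcc_of_le hxy] at hfin
    obtain ⟨m, ⟨hmB, hm⟩, hmax⟩ := Set.exists_max_image (B ∩ Set.Icc x y) id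
      (hfin.subset Set.inter_subset_right) ⟨x, hx, le_rfl, hxy⟩
    rcases hm.2.eq_or_lt with rfl | hlt
    · exact hmB
    obtain ⟨c, hc, hcy⟩ := (h.right_of_le hm.1 hm.2).exists_covBy_le hlt
    have hcB : c ∈ B := hc.sFun_eq ▸ (hB m hmB).1
    exact absurd hc.lt (hmax c ⟨hcB, hm.1.trans hc.le, hcy⟩).not_gt
  · rw [Set.uIcc_of_ge hyx] at hfin
    obtain ⟨m, ⟨hmB, hm⟩, hmin⟩ := Set.exists_min_image (B ∩ Set.Icc y x) id
      (hfin.subset Set.inter_subset_right) ⟨x, hx, hyx, le_rfl⟩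
    rcases hm.1.eq_or_lt with rfl | hlt
    · exact hmB
    obtain ⟨c, hc, hcy⟩ := (h.symm.left_of_le hm.1 hm.2).exists_le_covBy hlt
    have hcB : c ∈ B := hc.pFun_eq ▸ (hB m hmB).2
    exact absurd hc.lt (hmin c ⟨hcB, hcy, hc.le.trans hm.2⟩).not_gt

/-- The closure of a set under `s` and `p` is the union of the blocks of its elements. -/
theorem mem_spClosure {A : Set L} {y : L} : y ∈ spClosure L A ↔ ∃ x ∈ A, Sim1 x y := by
  constructor
  · intro h
    refine h {y | ∃ x ∈ A, Sim1 x y} ⟨fun x hx => ⟨x, hx, Sim1.refl x⟩, ?_⟩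
    rintro y ⟨x, hx, hxy⟩
    exact ⟨⟨x, hx, hxy.trans (sim1_sFun y)⟩, ⟨x, hx, hxy.trans (sim1_pFun y)⟩⟩
  · rintro ⟨x, hx, hxy⟩ B ⟨hAB, hB⟩
    exact hxy.mem_of_closed hB (hAB hx)

theorem OrderIso.map_sFun (σ : L ≃o L) (x : L) : σ (sFun x) = sFun (σ x) := by
  by_cases h : ∃ y, x ⋖ y
  · obtain ⟨y, h⟩ := h
    rw [h.sFun_eq, ((apply_covBy_apply_iff σ).2 h).sFun_eq]
  · rw [sFun_eq_self h, sFun_eq_self]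
    rintro ⟨y, hy⟩
    exact h ⟨σ.symm y, by simpa using (apply_covBy_apply_iff σ.symm).2 hy⟩

theorem OrderIso.map_pFun (σ : L ≃o L) (x : L) : σ (pFun x) = pFun (σ x) := by
  by_cases h : ∃ y, y ⋖ x
  · obtain ⟨y, h⟩ := h
    rw [h.pFun_eq, ((apply_covBy_apply_iff σ).2 h).pFun_eq]
  · rw [pFun_eq_self h, pFun_eq_self]
    rintro ⟨y, hy⟩
    exact h ⟨σ.symm y, by simpa using (apply_covBy_apply_iff σ.symm).2 hy⟩

/-- The block of `x`, as an element of the condensation. -/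
def toBlock (x : L) : Blocks L := ⟨spBlock L x, x, rfl⟩

theorem toBlock_surjective : Function.Surjective (toBlock : L → Blocks L) := by
  rintro ⟨_, x, rfl⟩
  exact ⟨x, rfl⟩

theorem mem_toBlock {x y : L} : y ∈ (toBlock x).1 ↔ Sim1 x y := Iff.rfl

theorem toBlock_eq_iff {x y : L} : toBlock x = toBlock y ↔ Sim1 x y := by
  refine ⟨fun h => ?_, fun h => Subtype.ext (Set.ext fun z => ⟨h.symm.trans, h.trans⟩)⟩
  rw [← mem_toBlock, h]
  exact Sim1.refl y

theorem mem_block_iff {x : L} {B : Blocks L} : x ∈ B.1 ↔ toBlock x = B := by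
  obtain ⟨y, rfl⟩ := toBlock_surjective B
  rw [mem_toBlock, eq_comm, toBlock_eq_iff]

theorem blocksLT_toBlock_iff {x y : L} :
    BlocksLT L (toBlock x) (toBlock y) ↔ x < y ∧ ¬ Sim1 x y := by
  constructor
  · rintro ⟨a, ha, b, hb, hab, hn⟩
    rw [mem_toBlock] at ha hb
    have hxy : ¬ Sim1 x y := fun h => hn (ha.symm.trans (h.trans hb))
    refine ⟨lt_of_not_ge fun hyx => ?_, hxy⟩
    rcases le_total b x with hbx | hxb
    · exact hn (ha.symm.left_of_le hab.le hbx)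
    · exact hxy (hb.left_of_le hyx hxb).symm
  · rintro ⟨h, h'⟩
    exact ⟨x, Sim1.refl x, y, Sim1.refl y, h, h'⟩

theorem BlocksLT.lt {x y : L} (h : BlocksLT L (toBlock x) (toBlock y)) : x < y :=
  (blocksLT_toBlock_iff.1 h).1

theorem locallyFinite_block (B : Blocks L) (a b : B.1) : (Set.Icc a b).Finite := by
  obtain ⟨x, rfl⟩ := toBlock_surjective B
  have hab : Sim1 (a : L) b := (mem_toBlock.1 a.2).symm.trans b.2
  rw [sim1_iff_finite_uIcc] at hab
  refine (hab.preimage Subtype.val_injective.injOn).subset fun z hz => ?_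
  exact Set.Icc_subset_uIcc ⟨hz.1, hz.2⟩

/-- An infinite locally finite linear order has order type `ω`, `ω*` or `ζ`. -/
theorem nonempty_orderIso_of_locallyFinite (α : Type*) [LinearOrder α] [Infinite α]
    (h : ∀ a b : α, (Set.Icc a b).Finite) :
    Nonempty (α ≃o ℕ) ∨ Nonempty (α ≃o ℕᵒᵈ) ∨ Nonempty (α ≃o ℤ) := by
  let := LocallyFiniteOrder.ofFiniteIcc h
  let := LinearLocallyFiniteOrder.succOrder α
  let := LinearLocallyFiniteOrder.predOrder α
  by_cases hmin : ∃ m : α, ∀ a, m ≤ a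
  · obtain ⟨m, hm⟩ := hmin
    let : OrderBot α := { bot := m, bot_le := hm }
    have : NoMaxOrder α := by
      refine ⟨fun a => by_contra fun ha => ?_⟩
      push Not at ha
      exact Set.infinite_univ ((h m a).subset fun z _ => ⟨hm z, ha z⟩)
    exact Or.inl ⟨orderIsoNatOfLinearSuccPredArch⟩
  · push Not at hmin
    have : NoMinOrder α := ⟨hmin⟩
    by_cases hmax : ∃ m : α, ∀ a, a ≤ m
    · obtain ⟨m, hm⟩ := hmax
      let : OrderTop α := { top := m, le_top := hm }
      exact Or.inr (Or.inl ⟨(orderIsoNatOfLinearSuccPredArch (ι := αᵒᵈ)).dual⟩)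
    · push Not at hmax
      have : NoMaxOrder α := ⟨hmax⟩
      exact Or.inr (Or.inr ⟨orderIsoIntOfLinearSuccPredArch⟩)

theorem blockColor_eq_iff {B C : Blocks L} :
    blockColor B.1 = blockColor C.1 ↔ Nonempty (B.1 ≃o C.1) := by
  classical
  constructor
  · intro h
    by_cases hB : B.1.Finite
    · by_cases hC : C.1.Finite
      · rw [blockColor, blockColor, if_pos hB, if_pos hC] at h
        have hcard : hC.toFinset.card = hB.toFinset.card := by
          rw [← Set.ncard_eq_toFinset_card _ hC, ← Set.ncard_eq_toFinset_card _ hB]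
          exact (Sum.inl_injective h).symm
        have e := (hB.toFinset.orderIsoOfFin rfl).symm.trans (hC.toFinset.orderIsoOfFin hcard)
        exact ⟨(OrderIso.setCongr _ _ hB.coe_toFinset).symm.trans
          (e.trans (OrderIso.setCongr _ _ hC.coe_toFinset))⟩
      · rw [blockColor, blockColor, if_pos hB, if_neg hC] at h
        split_ifs at h
    · by_cases hC : C.1.Finite
      · rw [blockColor, blockColor, if_neg hB, if_pos hC] at h
        split_ifs at h
      · have := Set.infinite_coe_iff.2 hB
        have := Set.infinite_coe_iff.2 hC
        have tB := nonempty_orderIso_of_locallyFinite B.1 (locallyFinite_block B)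
        have tC := nonempty_orderIso_of_locallyFinite C.1 (locallyFinite_block C)
        rw [blockColor, blockColor, if_neg hB, if_neg hC] at h
        have trans {α : Type} [LinearOrder α] (e : Nonempty (B.1 ≃o α))
            (e' : Nonempty (C.1 ≃o α)) : Nonempty (B.1 ≃o C.1) :=
          ⟨e.some.trans e'.some.symm⟩
        by_cases hB0 : Nonempty (B.1 ≃o ℕ) <;> by_cases hC0 : Nonempty (C.1 ≃o ℕ) <;>
          by_cases hB1 : Nonempty (B.1 ≃o ℕᵒᵈ) <;> by_cases hC1 : Nonempty (C.1 ≃o ℕᵒᵈ) <;>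
          simp only [hB0, hC0, hB1, hC1, if_true, if_false, false_or] at h tB tC <;>
          first
          | exact trans hB0 hC0
          | exact trans hB1 hC1
          | exact trans tB tC
          | simp at h
  · rintro ⟨e⟩
    have hfin : B.1.Finite ↔ C.1.Finite := e.toEquiv.finite_iff
    have hcard : B.1.ncard = C.1.ncard := Nat.card_congr e.toEquiv
    have hiso (α : Type) [LinearOrder α] : Nonempty (B.1 ≃o α) ↔ Nonempty (C.1 ≃o α) :=
      ⟨fun ⟨f⟩ => ⟨e.symm.trans f⟩, fun ⟨f⟩ => ⟨e.trans f⟩⟩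
    rw [blockColor, blockColor, hcard]
    exact if_congr hfin rfl (if_congr (hiso ℕ) rfl (if_congr (hiso ℕᵒᵈ) rfl rfl))

theorem exists_strictMonoOn_of_blockColor_eq {B C : Blocks L}
    (h : blockColor B.1 = blockColor C.1) :
    ∃ f : L → L, Set.BijOn f B.1 C.1 ∧ StrictMonoOn f B.1 := by
  classical
  obtain ⟨e⟩ := blockColor_eq_iff.1 h
  have hf {x : L} (hx : x ∈ B.1) : (if hx : x ∈ B.1 then (e ⟨x, hx⟩ : L) else x) = e ⟨x, hx⟩ :=
    dif_pos hx
  have hmono : StrictMonoOn (fun x => if hx : x ∈ B.1 then (e ⟨x, hx⟩ : L) else x) B.1 := by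
    intro x hx y hy hxy
    simp only [hf hx, hf hy]
    exact e.strictMono hxy
  refine ⟨_, ⟨fun x hx => ?_, hmono.injOn, fun y hy => ?_⟩, hmono⟩
  · simp only [hf hx]
    exact (e ⟨x, hx⟩).2
  · refine ⟨e.symm ⟨y, hy⟩, (e.symm ⟨y, hy⟩).2, ?_⟩
    refine (hf (e.symm ⟨y, hy⟩).2).trans ?_
    rw [Subtype.coe_eta, e.apply_symm_apply]

theorem blockColor_eq_of_strictMonoOn {B C : Blocks L} {f : L → L}
    (hf : Set.BijOn f B.1 C.1) (hmono : StrictMonoOn f B.1) :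
    blockColor B.1 = blockColor C.1 :=
  blockColor_eq_iff.2 ⟨(hmono.orderIso f B.1).trans (OrderIso.setCongr _ _ hf.image_eq)⟩

theorem mem_block_of_sim1 {B : Blocks L} {x y : L} (hx : x ∈ B.1) (h : Sim1 x y) : y ∈ B.1 := by
  rw [mem_block_iff] at *
  rw [← hx, eq_comm, toBlock_eq_iff]
  exact h

theorem covBy_iff_of_strictMonoOn {B C : Blocks L} {f : L → L}
    (hf : Set.BijOn f B.1 C.1) (hmono : StrictMonoOn f B.1) {x y : L} (hx : x ∈ B.1)
    (hy : y ∈ B.1) : f x ⋖ f y ↔ x ⋖ y := by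
  constructor
  · intro h
    refine ⟨(hmono.lt_iff_lt hx hy).1 h.lt, fun z hxz hzy => ?_⟩
    have hxy : Sim1 x y := toBlock_eq_iff.1 ((mem_block_iff.1 hx).trans (mem_block_iff.1 hy).symm)
    have hz : z ∈ B.1 := mem_block_of_sim1 hx (hxy.left_of_le hxz.le hzy.le)
    exact h.2 (hmono hx hz hxz) (hmono hz hy hzy)
  · intro h
    refine ⟨hmono hx hy h.lt, fun w hxw hwy => ?_⟩
    have hxy : Sim1 (f x) (f y) := toBlock_eq_iff.1
      ((mem_block_iff.1 (hf.mapsTo hx)).trans (mem_block_iff.1 (hf.mapsTo hy)).symm)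
    have hw : w ∈ C.1 := mem_block_of_sim1 (hf.mapsTo hx) (hxy.left_of_le hxw.le hwy.le)
    obtain ⟨z, hz, rfl⟩ := hf.surjOn hw
    exact h.2 ((hmono.lt_iff_lt hx hz).1 hxw) ((hmono.lt_iff_lt hz hy).1 hwy)

theorem map_sFun_of_strictMonoOn {B C : Blocks L} {f : L → L}
    (hf : Set.BijOn f B.1 C.1) (hmono : StrictMonoOn f B.1) {x : L} (hx : x ∈ B.1) :
    f (sFun x) = sFun (f x) := by
  by_cases h : ∃ y, x ⋖ y
  · obtain ⟨y, h⟩ := h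
    rw [h.sFun_eq,
      ((covBy_iff_of_strictMonoOn hf hmono hx (mem_block_of_sim1 hx h.sim1)).2 h).sFun_eq]
  · rw [sFun_eq_self h, sFun_eq_self]
    rintro ⟨y, hy⟩
    obtain ⟨z, hz, rfl⟩ := hf.surjOn (mem_block_of_sim1 (hf.mapsTo hx) hy.sim1)
    exact h ⟨z, (covBy_iff_of_strictMonoOn hf hmono hx hz).1 hy⟩

theorem map_pFun_of_strictMonoOn {B C : Blocks L} {f : L → L}
    (hf : Set.BijOn f B.1 C.1) (hmono : StrictMonoOn f B.1) {x : L} (hx : x ∈ B.1) :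
    f (pFun x) = pFun (f x) := by
  by_cases h : ∃ y, y ⋖ x
  · obtain ⟨y, h⟩ := h
    rw [h.pFun_eq,
      ((covBy_iff_of_strictMonoOn hf hmono (mem_block_of_sim1 hx h.sim1.symm) hx).2 h).pFun_eq]
  · rw [pFun_eq_self h, pFun_eq_self]
    rintro ⟨y, hy⟩
    obtain ⟨z, hz, rfl⟩ := hf.surjOn (mem_block_of_sim1 (hf.mapsTo hx) hy.sim1.symm)
    exact h ⟨z, (covBy_iff_of_strictMonoOn hf hmono hz hx).1 hy⟩

/-- Strictly monotone maps between blocks glue along a map of blocks that preserves the order. -/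
theorem strictMonoOn_glue {S : Set (Blocks L)} {τ : Blocks L → Blocks L}
    (hτ : ∀ B ∈ S, ∀ C ∈ S, BlocksLT L B C → BlocksLT L (τ B) (τ C))
    {f : Blocks L → L → L} (hmaps : ∀ B ∈ S, Set.MapsTo (f B) B.1 (τ B).1)
    (hmono : ∀ B ∈ S, StrictMonoOn (f B) B.1) :
    StrictMonoOn (fun x => f (toBlock x) x) (toBlock ⁻¹' S) := by
  intro x hx y hy hxy
  by_cases h : Sim1 x y
  · have hB := toBlock_eq_iff.2 h
    simp only [← hB]
    exact hmono _ hx (Sim1.refl x) h hxy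
  · have hlt := hτ _ hx _ hy (blocksLT_toBlock_iff.2 ⟨hxy, h⟩)
    rw [← mem_block_iff.1 (hmaps _ hx (Sim1.refl x)),
      ← mem_block_iff.1 (hmaps _ hy (Sim1.refl y))] at hlt
    exact hlt.lt

/-- The automorphism of the condensation induced by an automorphism of `L`. -/
noncomputable def blocksEquiv (σ : L ≃o L) : Blocks L ≃ Blocks L where
  toFun B := toBlock (σ (Function.surjInv toBlock_surjective B))
  invFun B := toBlock (σ.symm (Function.surjInv toBlock_surjective B))
  left_inv B := by
    conv_rhs => rw [← Function.surjInv_eq toBlock_surjective B]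
    rw [toBlock_eq_iff, ← sim1_orderIso_iff σ, σ.apply_symm_apply, ← toBlock_eq_iff,
      Function.surjInv_eq toBlock_surjective]
  right_inv B := by
    conv_rhs => rw [← Function.surjInv_eq toBlock_surjective B]
    rw [toBlock_eq_iff, ← sim1_orderIso_iff σ.symm, σ.symm_apply_apply, ← toBlock_eq_iff,
      Function.surjInv_eq toBlock_surjective]

theorem blocksEquiv_toBlock (σ : L ≃o L) (x : L) :
    blocksEquiv σ (toBlock x) = toBlock (σ x) := by
  refine toBlock_eq_iff.2 ((sim1_orderIso_iff σ).2 (toBlock_eq_iff.1 ?_))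
  exact Function.surjInv_eq toBlock_surjective _

theorem blockColor_blocksEquiv (σ : L ≃o L) (B : Blocks L) :
    blockColor (blocksEquiv σ B).1 = blockColor B.1 := by
  obtain ⟨x, rfl⟩ := toBlock_surjective B
  rw [blocksEquiv_toBlock]
  refine (blockColor_eq_of_strictMonoOn (f := σ) ⟨?_, σ.injective.injOn, ?_⟩
    (σ.strictMono.strictMonoOn _)).symm
  · exact fun y hy => (sim1_orderIso_iff σ).2 hy
  · intro y hy
    refine ⟨σ.symm y, ?_, σ.apply_symm_apply y⟩
    rw [mem_toBlock, ← sim1_orderIso_iff σ, σ.apply_symm_apply]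
    exact hy

theorem blocksLT_blocksEquiv (σ : L ≃o L) (B C : Blocks L) :
    BlocksLT L B C ↔ BlocksLT L (blocksEquiv σ B) (blocksEquiv σ C) := by
  obtain ⟨x, rfl⟩ := toBlock_surjective B
  obtain ⟨y, rfl⟩ := toBlock_surjective C
  simp only [blocksEquiv_toBlock, blocksLT_toBlock_iff, σ.lt_iff_lt, sim1_orderIso_iff]

theorem IsSPHomogeneous.coloredHomogeneousRel (hL : IsSPHomogeneous L) :
    ColoredHomogeneousRel (BlocksLT L) (fun B : Blocks L => blockColor B.1) := by
  intro A g hinj hlt hcol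
  have hex (B : Blocks L) :
      ∃ f : L → L, B ∈ A → Set.BijOn f B.1 (g B).1 ∧ StrictMonoOn f B.1 := by
    by_cases hB : B ∈ A
    · obtain ⟨f, hf⟩ := exists_strictMonoOn_of_blockColor_eq (hcol B hB).symm
      exact ⟨f, fun _ => hf⟩
    · exact ⟨id, fun h => absurd h hB⟩
  choose f hf using hex
  have hblock {x : L} (hx : toBlock x ∈ A) : toBlock (f (toBlock x) x) = g (toBlock x) :=
    mem_block_iff.1 ((hf _ hx).1.mapsTo (Sim1.refl x))
  have hmono : StrictMonoOn (fun x => f (toBlock x) x) (toBlock ⁻¹' A) :=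
    strictMonoOn_glue (fun B hB C hC => (hlt B hB C hC).1) (fun B hB => (hf B hB).1.mapsTo)
      (fun B hB => (hf B hB).2)
  let rep : Blocks L → L := Function.surjInv toBlock_surjective
  have hrep (B : Blocks L) : toBlock (rep B) = B := Function.surjInv_eq toBlock_surjective B
  let a : Fin A.card → L := fun i => rep (A.equivFin.symm i)
  have hcla (y : L) : y ∈ spClosure L (Set.range a) ↔ toBlock y ∈ A := by
    rw [mem_spClosure]
    constructor
    · rintro ⟨_, ⟨i, rfl⟩, hi⟩
      rw [← toBlock_eq_iff.2 hi, hrep]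
      exact (A.equivFin.symm i).2
    · intro hy
      refine ⟨_, ⟨A.equivFin ⟨_, hy⟩, rfl⟩, toBlock_eq_iff.1 ?_⟩
      rw [hrep, Equiv.symm_apply_apply]
  have hablock (i) : toBlock (a i) ∈ A := by
    rw [hrep]
    exact (A.equivFin.symm i).2
  have hclb (y : L) : y ∈ spClosure L (Set.range fun i => f (toBlock (a i)) (a i)) ↔
      ∃ B ∈ A, g B = toBlock y := by
    rw [mem_spClosure]
    constructor
    · rintro ⟨_, ⟨i, rfl⟩, hi⟩
      exact ⟨_, hablock i, by rw [← toBlock_eq_iff.2 hi, hblock (hablock i)]⟩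
    · rintro ⟨B, hB, hBy⟩
      refine ⟨_, ⟨A.equivFin ⟨_, hB⟩, rfl⟩, toBlock_eq_iff.1 ?_⟩
      rw [hblock (hablock _), hrep, Equiv.symm_apply_apply, hBy]
  have hext : ∃ σ : L ≃o L, ∀ i, σ (a i) = f (toBlock (a i)) (a i) := by
    refine (hL A.card a (fun i => f (toBlock (a i)) (a i))
      ⟨fun x => f (toBlock x) x, ⟨fun x hx => ?_, ?_, fun y hy => ?_⟩, fun x hx y hy => ?_,
        fun x hx => ?_, fun x hx => ?_, fun i => rfl⟩).imp fun σ h => h.2.2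
    · rw [hcla] at hx
      exact (hclb _).2 ⟨_, hx, (hblock hx).symm⟩
    · exact hmono.injOn.mono fun x hx => (hcla x).1 hx
    · obtain ⟨B, hB, hBy⟩ := (hclb y).1 hy
      obtain ⟨x, hx, rfl⟩ := (hf B hB).1.surjOn (mem_block_iff.2 hBy.symm)
      rw [mem_block_iff] at hx
      subst hx
      exact ⟨x, (hcla x).2 hB, rfl⟩
    · exact (hmono.lt_iff_lt ((hcla x).1 hx) ((hcla y).1 hy)).symm
    · have h := hf _ ((hcla x).1 hx)
      simp only [← toBlock_eq_iff.2 (sim1_sFun x)]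
      exact map_sFun_of_strictMonoOn h.1 h.2 (Sim1.refl x)
    · have h := hf _ ((hcla x).1 hx)
      simp only [← toBlock_eq_iff.2 (sim1_pFun x)]
      exact map_pFun_of_strictMonoOn h.1 h.2 (Sim1.refl x)
  obtain ⟨σ, hσ⟩ := hext
  refine ⟨blocksEquiv σ, blocksLT_blocksEquiv σ, blockColor_blocksEquiv σ, fun B hB => ?_⟩
  have h := hσ (A.equivFin ⟨B, hB⟩)
  have haB : toBlock (a (A.equivFin ⟨B, hB⟩)) = B := by rw [hrep, Equiv.symm_apply_apply]
  rw [← haB, blocksEquiv_toBlock, h, hblock (hablock _)]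

theorem ColoredHomogeneousRel.isSPHomogeneous
    (h : ColoredHomogeneousRel (BlocksLT L) (fun B : Blocks L => blockColor B.1)) :
    IsSPHomogeneous L := by
  classical
  rintro n a b ⟨g, hbij, hlt, hs, hp, hab⟩
  set A := spClosure L (Set.range a) with hA
  have hAmem {x y : L} (hx : x ∈ A) (hxy : Sim1 x y) : y ∈ A := by
    rw [hA, mem_spClosure] at *
    obtain ⟨z, hz, hzx⟩ := hx
    exact ⟨z, hz, hzx.trans hxy⟩
  have haA (i) : a i ∈ A := mem_spClosure.2 ⟨a i, ⟨i, rfl⟩, Sim1.refl _⟩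
  have hmono : StrictMonoOn g A := fun x hx y hy => (hlt x hx y hy).1
  have hgblock {x : L} (hx : x ∈ A) : Set.BijOn g (toBlock x).1 (toBlock (g x)).1 := by
    refine ⟨fun y hy => ?_, hbij.injOn.mono fun y hy => hAmem hx hy, fun y hy => ?_⟩
    · refine (Sim1.mem_of_closed (B := {y | y ∈ A ∧ Sim1 (g x) (g y)}) ?_ hy
        ⟨hx, Sim1.refl _⟩).2
      rintro z ⟨hz, hxz⟩
      refine ⟨⟨hAmem hz (sim1_sFun z), ?_⟩, ⟨hAmem hz (sim1_pFun z), ?_⟩⟩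
      · rw [hs z hz]
        exact hxz.trans (sim1_sFun _)
      · rw [hp z hz]
        exact hxz.trans (sim1_pFun _)
    · refine Sim1.mem_of_closed ?_ hy ⟨x, Sim1.refl x, rfl⟩
      rintro _ ⟨z, hz, rfl⟩
      have hzA := hAmem hx hz
      exact ⟨⟨sFun z, Sim1.trans hz (sim1_sFun z), hs z hzA⟩,
        ⟨pFun z, Sim1.trans hz (sim1_pFun z), hp z hzA⟩⟩
  have hsim {x y : L} (hx : x ∈ A) (hy : y ∈ A) : Sim1 (g x) (g y) ↔ Sim1 x y := by
    refine ⟨fun hxy => ?_, fun hxy => (hgblock hx).mapsTo hxy⟩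
    obtain ⟨z, hz, hzy⟩ := (hgblock hx).surjOn hxy
    rw [← hbij.injOn (hAmem hx hz) hy hzy]
    exact hz
  let rep : Blocks L → L := Function.surjInv toBlock_surjective
  have hrep (B : Blocks L) : toBlock (rep B) = B := Function.surjInv_eq toBlock_surjective B
  have hrepA {B : Blocks L} (hB : B ∈ Finset.univ.image (fun i => toBlock (a i))) : rep B ∈ A := by
    obtain ⟨i, -, rfl⟩ := Finset.mem_image.1 hB
    exact hAmem (haA i) (toBlock_eq_iff.1 (hrep _).symm)
  obtain ⟨τ, hτlt, hτcol, hτ⟩ := h (Finset.univ.image (fun i => toBlock (a i))) (fun B => toBlock (g (rep B)))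
    (fun B hB C hC hBC => by
      rw [← hrep B, ← hrep C, toBlock_eq_iff, ← hsim (hrepA hB) (hrepA hC)]
      exact toBlock_eq_iff.1 hBC)
    (fun B hB C hC => by
      conv_lhs => rw [← hrep B, ← hrep C]
      rw [blocksLT_toBlock_iff, blocksLT_toBlock_iff, hsim (hrepA hB) (hrepA hC),
        hlt _ (hrepA hB) _ (hrepA hC)])
    (fun B hB => by
      have hB' := hgblock (hrepA hB)
      rw [hrep] at hB'
      exact (blockColor_eq_of_strictMonoOn hB' (hmono.mono fun y hy =>
        hAmem (hrepA hB) (by rwa [← mem_toBlock, hrep]))).symm)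
  have hτA {x : L} (hx : x ∈ A) : τ (toBlock x) = toBlock (g x) := by
    obtain ⟨_, ⟨i, rfl⟩, hi⟩ := mem_spClosure.1 hx
    rw [← toBlock_eq_iff.2 hi, hτ _ (Finset.mem_image.2 ⟨i, Finset.mem_univ i, rfl⟩),
      toBlock_eq_iff, hsim (hAmem (haA i) (toBlock_eq_iff.1 (hrep _).symm)) hx, ← toBlock_eq_iff,
      hrep]
    exact toBlock_eq_iff.2 hi
  have hex (B : Blocks L) : ∃ f : L → L, (Set.BijOn f B.1 (τ B).1 ∧ StrictMonoOn f B.1) ∧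
      ∀ x ∈ B.1, x ∈ A → f x = g x := by
    by_cases hB : rep B ∈ A
    · have hB' := hgblock hB
      rw [← hτA hB, hrep] at hB'
      exact ⟨g, ⟨hB', hmono.mono fun y hy => hAmem hB (by rwa [← mem_toBlock, hrep])⟩,
        fun _ _ _ => rfl⟩
    · obtain ⟨f, hf⟩ := exists_strictMonoOn_of_blockColor_eq (hτcol B).symm
      refine ⟨f, hf, fun x hx hxA => absurd (hAmem hxA ?_) hB⟩
      rw [← toBlock_eq_iff, hrep, mem_block_iff.1 hx]
  choose f hf hfg using hex
  have hglue : StrictMonoOn (fun x => f (toBlock x) x) (toBlock ⁻¹' Set.univ) :=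
    strictMonoOn_glue (fun B _ C _ => (hτlt B C).1) (fun B _ => (hf B).1.mapsTo)
      (fun B _ => (hf B).2)
  rw [Set.preimage_univ, strictMonoOn_univ] at hglue
  have hsurj : Function.Surjective fun x => f (toBlock x) x := by
    intro y
    obtain ⟨B, hB⟩ := τ.surjective (toBlock y)
    obtain ⟨x, hx, rfl⟩ := (hf B).1.surjOn (mem_block_iff.2 hB.symm)
    rw [mem_block_iff] at hx
    subst hx
    exact ⟨x, rfl⟩
  let σ := hglue.orderIsoOfSurjective _ hsurj
  exact ⟨σ, σ.map_sFun, σ.map_pFun, fun i =>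
    (hfg _ _ (Sim1.refl (a i)) (haA i)).trans (hab i)⟩

end Condensation

/-- A countable linear order `L` is sp-homogeneous iff its colored condensation `Φ(L)`
(the blocks of `L` with the induced order, each block colored by its order type) is a
homogeneous colored linear order. -/
theorem stmt5 (L : Type) [LinearOrder L] [Countable L] :
    IsSPHomogeneous L ↔
      ColoredHomogeneousRel (BlocksLT L) (fun B : Blocks L => blockColor B.1) := by
  exact ⟨IsSPHomogeneous.coloredHomogeneousRel, ColoredHomogeneousRel.isSPHomogeneous⟩
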